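/- Theorem 4, sufficiency: Let 𝒦 be a root class, A a group, and H a subgroup of A. If A is 𝒦-residual and H is a 𝒦-closed subgroup of A, then the generalized free square Q = A *_H A (the amalgamated free product of two copies of A amalgamating H via the identity map, i.e. the pushout of two copies of the inclusion H → A) is 𝒦-residual. -/

import Mathlib

open Pointwise

universe u

/-- A class of groups in universe `u`. -/
abbrev GroupClass : Type (u + 1) := ∀ (G : Type u) [Group G], Prop

/-- A class of groups is invariant under isomorphism. -/
def GroupClass.IsoInvariant (K : GroupClass.{u}) : Prop :=
  ∀ (G H : Type u) [Group G] [Group H], G ≃* H → K G → K H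

/-- A class of groups is closed under taking subgroups. -/
def GroupClass.SubgroupClosed (K : GroupClass.{u}) : Prop :=
  ∀ (G : Type u) [Group G], K G → ∀ H : Subgroup G, K H

/-- A class of groups is closed under binary direct products. -/
def GroupClass.ProdClosed (K : GroupClass.{u}) : Prop :=
  ∀ (A B : Type u) [Group A] [Group B], K A → K B → K (A × B)

/-- `K` is a root class: it is an isomorphism-invariant class of groups containing a
nontrivial group, closed under subgroups and finite direct products, and satisfying the
root condition on subnormal chains `C ⊴ B ⊴ A` of length two. -/
def IsRootClass (K : GroupClass.{u}) : Prop :=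
  K.IsoInvariant ∧
  (∃ (G : Type u) (_ : Group G), Nontrivial G ∧ K G) ∧
  K.SubgroupClosed ∧
  K.ProdClosed ∧
  (∀ (A : Type u) [Group A] (B : Subgroup A) [B.Normal] (C : Subgroup B) [C.Normal],
    K (A ⧸ B) → K ((B : Type u) ⧸ C) →
    ∃ (D : Subgroup A) (hD : D.Normal), D ≤ C.map B.subtype ∧ (letI := hD; K (A ⧸ D)))

/-- A group `G` is `K`-residual: every nonidentity element is excluded from some normal
subgroup with quotient in `K`. -/
def KResidual (K : GroupClass.{u}) (G : Type u) [Group G] : Prop :=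
  ∀ g : G, g ≠ 1 → ∃ (N : Subgroup G) (hN : N.Normal),
    (letI := hN; K (G ⧸ N)) ∧ g ∉ N

/-- A subgroup `H` of `A` is `K`-closed: every element of `A` outside `H` avoids the set
`N * H` for some normal subgroup `N` of `A` with `A ⧸ N ∈ K`. -/
def KClosed (K : GroupClass.{u}) {A : Type u} [Group A] (H : Subgroup A) : Prop :=
  ∀ a : A, a ∉ H → ∃ (N : Subgroup A) (hN : N.Normal),
    (letI := hN; K (A ⧸ N)) ∧ a ∉ (N : Set A) * (H : Set A)

/-- `g` is separated from `1` by a homomorphism onto a group in `K`. -/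
def KSep (K : GroupClass.{u}) {G : Type u} [Group G] (g : G) : Prop :=
  ∃ (P : Type u) (_ : Group P), K P ∧ ∃ f : G →* P, f g ≠ 1

theorem K_quot_ker {K : GroupClass.{u}} (hK : IsRootClass K) {G P : Type u} [Group G] [Group P]
    (hP : K P) (f : G →* P) : K (G ⧸ f.ker) :=
  hK.1 _ _ (QuotientGroup.quotientKerEquivRange f).symm (hK.2.2.1 P hP f.range)

theorem kResidual_of_sep {K : GroupClass.{u}} (hK : IsRootClass K) {G : Type u} [Group G]
    (h : ∀ g : G, g ≠ 1 → KSep K g) : KResidual K G := by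
  intro g hg
  obtain ⟨P, _, hP, f, hf⟩ := h g hg
  exact ⟨f.ker, inferInstance, K_quot_ker hK hP f, hf⟩

theorem sep_of_root {K : GroupClass.{u}} (hK : IsRootClass K) {G P R : Type u} [Group G] [Group P]
    [Group R] (hP : K P) (hR : K R) (f : G →* P) (q : f.ker →* R) (w : f.ker) (hw : q w ≠ 1) :
    KSep K (w : G) := by
  obtain ⟨D, hD, hle, hKD⟩ := hK.2.2.2.2 G f.ker q.ker (K_quot_ker hK hP f) (K_quot_ker hK hR q)
  refine ⟨G ⧸ D, inferInstance, hKD, QuotientGroup.mk' D, ?_⟩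
  intro h
  have h1 : (w : G) ∈ D := (QuotientGroup.eq_one_iff _).1 h
  obtain ⟨y, hy, hyw⟩ := hle h1
  have : y = w := Subtype.ext hyw
  exact hw (this ▸ hy)

theorem K_punit {K : GroupClass.{u}} (hK : IsRootClass K) : K PUnit.{u+1} := by
  obtain ⟨G, _, _, hG⟩ := hK.2.1
  exact hK.1 _ _ (MulEquiv.ofUnique (M := (⊥ : Subgroup G)) (N := PUnit.{u+1})) (hK.2.2.1 G hG ⊥)

theorem sep_list {K : GroupClass.{u}} (hK : IsRootClass K) {G : Type u} [Group G]
    (S : List G) (h : ∀ g ∈ S, KSep K g) :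
    ∃ (P : Type u) (_ : Group P), K P ∧ ∃ f : G →* P, ∀ g ∈ S, f g ≠ 1 := by
  induction S with
  | nil => exact ⟨PUnit, inferInstance, K_punit hK, 1, by simp⟩
  | cons a S ih =>
    obtain ⟨P, _, hP, f, hf⟩ := ih fun g hg => h g (List.mem_cons_of_mem _ hg)
    obtain ⟨R, _, hR, e, he⟩ := h a List.mem_cons_self
    refine ⟨P × R, inferInstance, hK.2.2.2.1 _ _ hP hR, f.prod e, ?_⟩
    intro g hg h1
    have h1a : f g = 1 := congrArg Prod.fst h1
    have h1b : e g = 1 := congrArg Prod.snd h1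
    rcases List.mem_cons.1 hg with rfl | hg
    · exact he h1b
    · exact hf g hg h1a

section Step
open Classical in
/-- The permutation attached to a generator: shift along `p x`, with label `c` on one edge. -/
noncomputable def stepPerm {X P C : Type*} [Group P] [Group C] (p : X → P) (x0 : X) (g0 : P)
    (c : C) (x : X) : Equiv.Perm (P × C) where
  toFun z := (p x * z.1, (if x = x0 ∧ z.1 = g0 then c else 1) * z.2)
  invFun z := ((p x)⁻¹ * z.1, (if x = x0 ∧ (p x)⁻¹ * z.1 = g0 then c else 1)⁻¹ * z.2)
  left_inv z := by
    refine Prod.ext (by simp) ?_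
    by_cases h : x = x0 ∧ z.1 = g0 <;> simp [h]
  right_inv z := by simp

variable {X P C : Type*} [Group P] [Group C]

/-- The action of the free group. -/
noncomputable def actHom (f : FreeGroup X →* P) (x0 : X) (g0 : P) (c : C) :
    FreeGroup X →* Equiv.Perm (P × C) :=
  FreeGroup.lift (stepPerm (fun x => f (FreeGroup.of x)) x0 g0 c)

theorem actHom_spec (f : FreeGroup X →* P) (x0 : X) (g0 : P) (c : C) (w : FreeGroup X) :
    ∀ g, ∃ k : C, ∀ s, actHom f x0 g0 c w (g, s) = (f w * g, k * s) := by
  induction w using FreeGroup.induction_on with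
  | C1 => intro g; exact ⟨1, by simp⟩
  | of x =>
    intro g
    exact ⟨(actHom f x0 g0 c (FreeGroup.of x) (g, 1)).2, fun s => by simp [actHom, stepPerm]⟩
  | inv_of x _ =>
    intro g
    exact ⟨(actHom f x0 g0 c (FreeGroup.of x)⁻¹ (g, 1)).2, fun s => by
      simp [actHom, stepPerm, Equiv.Perm.inv_def]⟩
  | mul x y hx hy =>
    intro g
    obtain ⟨k, hk⟩ := hy g
    obtain ⟨l, hl⟩ := hx (f y * g)
    exact ⟨l * k, fun s => by simp [hk, hl, mul_assoc]⟩

theorem actHom_fst (f : FreeGroup X →* P) (x0 : X) (g0 : P) (c : C) (w : FreeGroup X) (g : P)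
    (s : C) : (actHom f x0 g0 c w (g, s)).1 = f w * g := by
  obtain ⟨k, hk⟩ := actHom_spec f x0 g0 c w g
  rw [hk]

theorem actHom_snd (f : FreeGroup X →* P) (x0 : X) (g0 : P) (c : C) (w : FreeGroup X) (g : P)
    (s : C) : (actHom f x0 g0 c w (g, s)).2 = (actHom f x0 g0 c w (g, 1)).2 * s := by
  obtain ⟨k, hk⟩ := actHom_spec f x0 g0 c w g
  rw [hk, hk]; simp

/-- The label-counting homomorphism on the kernel. -/
noncomputable def kerHom (f : FreeGroup X →* P) (x0 : X) (g0 : P) (c : C) : f.ker →* C where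
  toFun w := (actHom f x0 g0 c w (1, 1)).2
  map_one' := by simp
  map_mul' a b := by
    have hb : actHom f x0 g0 c b (1, 1) = (1, (actHom f x0 g0 c b (1, 1)).2) := by
      refine Prod.ext ?_ rfl
      rw [actHom_fst]
      rw [mul_one]; exact b.2
    rw [Subgroup.coe_mul, map_mul, Equiv.Perm.mul_apply, hb, actHom_snd]

theorem actHom_true (f : FreeGroup X →* P) (x0 : X) (g0 : P) (c : C) (x : X) (S) (s : C)
    (h : ¬ (x = x0 ∧ f (FreeGroup.mk S) = g0))
    (ih : actHom f x0 g0 c (FreeGroup.mk S) (1, 1) = (f (FreeGroup.mk S), s)) :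
    actHom f x0 g0 c (FreeGroup.mk ((x, true) :: S)) (1, 1)
      = (f (FreeGroup.mk ((x, true) :: S)), s) := by
  have e : (FreeGroup.mk ((x, true) :: S)) = FreeGroup.of x * FreeGroup.mk S := by
    simp [FreeGroup.of, FreeGroup.mul_mk]
  rw [e, map_mul, Equiv.Perm.mul_apply, ih]
  simp [actHom, stepPerm, h]

theorem actHom_false (f : FreeGroup X →* P) (x0 : X) (g0 : P) (c : C) (x : X) (S) (s : C)
    (h : ¬ (x = x0 ∧ f (FreeGroup.mk ((x, false) :: S)) = g0))
    (ih : actHom f x0 g0 c (FreeGroup.mk S) (1, 1) = (f (FreeGroup.mk S), s)) :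
    actHom f x0 g0 c (FreeGroup.mk ((x, false) :: S)) (1, 1)
      = (f (FreeGroup.mk ((x, false) :: S)), s) := by
  have e : (FreeGroup.mk ((x, false) :: S)) = (FreeGroup.of x)⁻¹ * FreeGroup.mk S := by
    simp [FreeGroup.of, FreeGroup.mul_mk, FreeGroup.inv_mk, FreeGroup.invRev]
  rw [e, map_mul, map_inv] at h
  rw [e, map_mul, Equiv.Perm.mul_apply, ih]
  simp [actHom, stepPerm, Equiv.Perm.inv_def, h]

theorem actHom_true_cross (f : FreeGroup X →* P) (c : C) (x : X) (S)
    (ih : actHom f x (f (FreeGroup.mk S)) c (FreeGroup.mk S) (1, 1) = (f (FreeGroup.mk S), 1)) :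
    (actHom f x (f (FreeGroup.mk S)) c (FreeGroup.mk ((x, true) :: S)) (1, 1)).2 = c := by
  have e : (FreeGroup.mk ((x, true) :: S)) = FreeGroup.of x * FreeGroup.mk S := by
    simp [FreeGroup.of, FreeGroup.mul_mk]
  rw [e, map_mul, Equiv.Perm.mul_apply, ih]
  simp [actHom, stepPerm]

theorem actHom_false_cross (f : FreeGroup X →* P) (c : C) (x : X) (S)
    (h : f (FreeGroup.mk ((x, false) :: S)) = 1)
    (ih : actHom f x 1 c (FreeGroup.mk S) (1, 1) = (f (FreeGroup.mk S), 1)) :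
    (actHom f x 1 c (FreeGroup.mk ((x, false) :: S)) (1, 1)).2 = c⁻¹ := by
  have e : (FreeGroup.mk ((x, false) :: S)) = (FreeGroup.of x)⁻¹ * FreeGroup.mk S := by
    simp [FreeGroup.of, FreeGroup.mul_mk, FreeGroup.inv_mk, FreeGroup.invRev]
  rw [e, map_mul, map_inv] at h
  rw [e, map_mul, Equiv.Perm.mul_apply, ih]
  simp [actHom, stepPerm, Equiv.Perm.inv_def, h]

theorem mk_app (f : FreeGroup X →* P) (S T : List (X × Bool)) :
    f (FreeGroup.mk (S ++ T)) = f (FreeGroup.mk S) * f (FreeGroup.mk T) := by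
  rw [← map_mul, FreeGroup.mul_mk]

theorem exists_kerHom (f : FreeGroup X →* P) (c : C) (hc : c ≠ 1) (y : X × Bool)
    (T : List (X × Bool)) (hred : FreeGroup.IsReduced (y :: T))
    (h1 : f (FreeGroup.mk (y :: T)) = 1)
    (hinf : ∀ M, M <:+: y :: T → M ≠ [] → M.length < (y :: T).length → f (FreeGroup.mk M) ≠ 1) :
    ∃ q : f.ker →* C, q ⟨FreeGroup.mk (y :: T), h1⟩ ≠ 1 := by
  have hT : ∀ M, M <:+: T → M ≠ [] → f (FreeGroup.mk M) ≠ 1 := fun M hM h =>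
    hinf M (hM.trans (List.suffix_cons y T).isInfix) h
      (by have := hM.length_le; simp; omega)
  obtain ⟨x0, b⟩ := y
  cases b with
  | true =>
    refine ⟨kerHom f x0 (f (FreeGroup.mk T)) c, ?_⟩
    have key : ∀ S, S <:+ T →
        actHom f x0 (f (FreeGroup.mk T)) c (FreeGroup.mk S) (1, 1) = (f (FreeGroup.mk S), 1) := by
      intro S
      induction S with
      | nil => intro _; simp [← FreeGroup.one_eq_mk]
      | cons z S ih =>
        intro hS
        have ih := ih ((List.suffix_cons z S).trans hS)
        obtain ⟨R, hR⟩ := hS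
        obtain ⟨x, b⟩ := z
        cases b with
        | true =>
          apply actHom_true _ _ _ _ _ _ _ _ ih
          rintro ⟨rfl, h⟩
          have e : T = (R ++ [(x, true)]) ++ S := by simp [← hR]
          refine hT (R ++ [(x, true)]) ⟨[], S, by simp [← hR]⟩ (by simp) ?_
          rw [e, mk_app] at h
          simpa using h
        | false =>
          apply actHom_false _ _ _ _ _ _ _ _ ih
          rintro ⟨rfl, h⟩
          by_cases hRn : R = []
          · subst hRn
            simp at hR
            subst hR
            simp [FreeGroup.IsReduced] at hred
          · refine hT R ⟨[], _, by simpa using hR⟩ hRn ?_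
            rw [← hR, mk_app] at h
            simpa using h
    change (actHom f x0 _ c (FreeGroup.mk ((x0, true) :: T)) (1, 1)).2 ≠ 1
    rw [actHom_true_cross f c x0 T (key T List.suffix_rfl)]
    exact hc
  | false =>
    refine ⟨kerHom f x0 1 c, ?_⟩
    have key : ∀ S, S <:+ T →
        actHom f x0 1 c (FreeGroup.mk S) (1, 1) = (f (FreeGroup.mk S), 1) := by
      intro S
      induction S with
      | nil => intro _; simp [← FreeGroup.one_eq_mk]
      | cons z S ih =>
        intro hS'
        have hS := hS'
        have ih := ih ((List.suffix_cons z S).trans hS)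
        obtain ⟨R, hR⟩ := hS
        obtain ⟨x, b⟩ := z
        cases b with
        | true =>
          apply actHom_true _ _ _ _ _ _ _ _ ih
          rintro ⟨rfl, h⟩
          by_cases hSn : S = []
          · subst hSn
            by_cases hRn : R = []
            · subst hRn
              simp at hR
              subst hR
              simp [FreeGroup.IsReduced] at hred
            · refine hT R ⟨[], _, by simpa using hR⟩ hRn ?_
              have e : (x, false) :: T = [(x, false)] ++ (R ++ [(x, true)]) := by simp [← hR]
              have e2 : FreeGroup.mk [(x, false)] = (FreeGroup.mk [(x, true)])⁻¹ := by
                simp [FreeGroup.inv_mk, FreeGroup.invRev]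
              rw [e, mk_app, mk_app, e2, map_inv] at h1
              have h2 := inv_mul_eq_one.1 h1
              exact (mul_eq_right.1 h2.symm)
          · exact hT S ⟨R ++ [(x, true)], [], by simp [← hR]⟩ hSn h
        | false =>
          apply actHom_false _ _ _ _ _ _ _ _ ih
          rintro ⟨rfl, h⟩
          exact hT _ hS'.isInfix (by simp) h
    change (actHom f x0 _ c (FreeGroup.mk ((x0, false) :: T)) (1, 1)).2 ≠ 1
    rw [actHom_false_cross f c x0 T h1 (key T List.suffix_rfl)]
    simpa using hc

end Step

theorem free_sep_list {K : GroupClass.{u}} (hK : IsRootClass K) (X : Type u) (n : ℕ) :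
    ∀ L : List (X × Bool), L.length = n → FreeGroup.IsReduced L → L ≠ [] →
      KSep K (FreeGroup.mk L) := by
  induction n using Nat.strong_induction_on with
  | _ n ih =>
  intro L hL hred hne
  classical
  let S := (L.sublists.filter fun M => M <:+: L ∧ M ≠ [] ∧ M.length < L.length).map
    (FreeGroup.mk : _ → FreeGroup X)
  obtain ⟨P, _, hP, f, hf⟩ := sep_list hK S (by
    intro g hg
    simp only [S, List.mem_map, List.mem_filter, decide_eq_true_eq] at hg
    obtain ⟨M, ⟨_, h1, h2, h3⟩, rfl⟩ := hg
    exact ih _ (hL ▸ h3) M rfl (hred.infix h1) h2)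
  by_cases h1 : f (FreeGroup.mk L) = 1
  · obtain ⟨C, _, hC, hKC⟩ := hK.2.1
    obtain ⟨c, hc⟩ := exists_ne (1 : C)
    obtain ⟨y, T, rfl⟩ := List.exists_cons_of_ne_nil hne
    obtain ⟨q, hq⟩ := exists_kerHom f c hc y T hred h1 (by
      intro M h1 h2 h3
      apply hf
      simp only [S, List.mem_map, List.mem_filter, decide_eq_true_eq]
      exact ⟨M, ⟨List.mem_sublists.2 h1.sublist, h1, h2, h3⟩, rfl⟩)
    exact sep_of_root hK hP hKC f q _ hq
  · exact ⟨P, _, hP, f, h1⟩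

theorem free_sep {K : GroupClass.{u}} (hK : IsRootClass K) (X : Type u) (w : FreeGroup X)
    (hw : w ≠ 1) : KSep K w := by
  classical
  rw [← FreeGroup.mk_toWord (x := w)]
  exact free_sep_list hK X _ _ rfl FreeGroup.isReduced_toWord
    (by simpa [FreeGroup.toWord_eq_nil_iff] using hw)

theorem KSep.of_hom {K : GroupClass.{u}} {G G' : Type u} [Group G] [Group G'] (f : G →* G') {g : G}
    (h : KSep K (f g)) : KSep K g := by
  obtain ⟨P, _, hP, e, he⟩ := h
  exact ⟨P, _, hP, e.comp f, he⟩

theorem closed_list {K : GroupClass.{u}} (hK : IsRootClass K) {A : Type u} [Group A]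
    {H : Subgroup A} (hH : KClosed K H) (S : List A) (hS : ∀ s ∈ S, s ∉ H) :
    ∃ (P : Type u) (_ : Group P), K P ∧ ∃ f : A →* P, ∀ s ∈ S, s ∉ f.ker ⊔ H := by
  induction S with
  | nil => exact ⟨PUnit, inferInstance, K_punit hK, 1, by simp⟩
  | cons a S ih =>
    obtain ⟨P, _, hP, f, hf⟩ := ih fun g hg => hS g (List.mem_cons_of_mem _ hg)
    obtain ⟨N, hN, hR, he⟩ := hH a (hS a List.mem_cons_self)
    refine ⟨P × (A ⧸ N), inferInstance, hK.2.2.2.1 _ _ hP hR, f.prod (QuotientGroup.mk' N), ?_⟩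
    intro g hg h1
    rcases List.mem_cons.1 hg with rfl | hg
    · apply he
      rw [← Subgroup.normal_mul]
      refine sup_le_sup_right ?_ H h1
      intro x hx
      have : (QuotientGroup.mk' N) x = 1 := congrArg Prod.snd hx
      exact (QuotientGroup.eq_one_iff _).1 this
    · refine hf g hg (sup_le_sup_right ?_ H h1)
      intro x hx
      exact congrArg Prod.fst hx

theorem isReduced_map {X Y : Type*} (p : X → Y) (L : List (X × Bool))
    (hL : FreeGroup.IsReduced L) (hp : ∀ a ∈ L, ∀ b ∈ L, p a.1 = p b.1 → a.1 = b.1) :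
    FreeGroup.IsReduced (L.map fun x => (p x.1, x.2)) := by
  induction L with
  | nil => simp
  | cons a L ih =>
    cases L with
    | nil => simp
    | cons b L =>
      have ih := ih (List.isChain_cons_cons.1 hL).2 fun a ha b hb =>
        hp a (List.mem_cons_of_mem _ ha) b (List.mem_cons_of_mem _ hb)
      refine List.isChain_cons_cons.2 ⟨?_, ih⟩
      intro h
      exact (List.isChain_cons_cons.1 hL).1 (hp a (by simp) b (by simp) h)

theorem free_map_ne {X Y : Type*} [DecidableEq X] (p : X → Y) (w : FreeGroup X) (hw : w ≠ 1)
    (hp : ∀ a ∈ w.toWord, ∀ b ∈ w.toWord, p a.1 = p b.1 → a.1 = b.1) :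
    FreeGroup.map p w ≠ 1 := by
  classical
  have h := isReduced_map p w.toWord FreeGroup.isReduced_toWord hp
  intro h1
  rw [← FreeGroup.mk_toWord (x := w), FreeGroup.map.mk, ← FreeGroup.toWord_eq_nil_iff,
    FreeGroup.toWord_mk, h.reduce_eq] at h1
  simp [FreeGroup.toWord_eq_nil_iff] at h1
  exact hw h1

/-- The action of `A` on the free group on `A ⧸ H`. -/
def cosetAut {A : Type u} [Group A] (H : Subgroup A) : A →* MulAut (FreeGroup (A ⧸ H)) where
  toFun a := FreeGroup.freeGroupCongr (MulAction.toPerm a)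
  map_one' := by
    ext w
    have : (fun x : A ⧸ H => (1 : A) • x) = id := by ext x; simp
    change FreeGroup.map (fun x : A ⧸ H => (1 : A) • x) w = w
    rw [this, FreeGroup.map.id]
  map_mul' a b := by
    ext w
    change FreeGroup.map (fun x : A ⧸ H => (a * b) • x) w =
      FreeGroup.map (fun x : A ⧸ H => a • x) (FreeGroup.map (fun x : A ⧸ H => b • x) w)
    rw [FreeGroup.map.comp]
    congr 2
    ext x
    simp [mul_smul]

theorem cosetAut_apply {A : Type u} [Group A] (H : Subgroup A) (a : A) (w : FreeGroup (A ⧸ H)) :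
    cosetAut H a w = FreeGroup.map (fun x : A ⧸ H => a • x) w := rfl

/-- On the preimage of `N`, project to the free group on cosets of `N ⊔ H`. -/
def projKer {A P : Type u} [Group A] [Group P] (H : Subgroup A) (f : A →* P) :
    (f.comp (SemidirectProduct.rightHom (φ := cosetAut H))).ker →* FreeGroup (A ⧸ (f.ker ⊔ H)) where
  toFun w := FreeGroup.map (Subgroup.quotientMapOfLE (le_sup_right : H ≤ f.ker ⊔ H)) w.1.left
  map_one' := by simp
  map_mul' a b := by
    have ha : f a.1.right = 1 := a.2
    rw [Subgroup.coe_mul, SemidirectProduct.mul_left, map_mul, cosetAut_apply, FreeGroup.map.comp]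
    congr 3
    ext x
    induction x using QuotientGroup.induction_on with
    | H x =>
    change ((a.1.right * x : A) : A ⧸ (f.ker ⊔ H)) = (x : A ⧸ (f.ker ⊔ H))
    rw [QuotientGroup.eq]
    apply Subgroup.mem_sup_left
    simp [MonoidHom.mem_ker, ha]

theorem semidirect_sep {K : GroupClass.{u}} (hK : IsRootClass K) {A : Type u} [Group A]
    {H : Subgroup A} (hA : KResidual K A) (hH : KClosed K H)
    (z : FreeGroup (A ⧸ H) ⋊[cosetAut H] A) (hz : z ≠ 1) : KSep K z := by
  classical
  by_cases hr : z.right = 1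
  · have hl : z.left ≠ 1 := fun h => hz (SemidirectProduct.ext h hr)
    let L := z.left.toWord
    let S := ((L.product L).map fun p => (p.1.1.out)⁻¹ * p.2.1.out).filter (· ∉ H)
    obtain ⟨P, _, hP, f, hf⟩ := closed_list hK hH S (by
      intro s hs
      simpa using (List.mem_filter.1 hs).2)
    have hz1 : z ∈ (f.comp (SemidirectProduct.rightHom (φ := cosetAut H))).ker := by
      change f z.right = 1
      rw [hr, map_one]
    have hne : projKer H f ⟨z, hz1⟩ ≠ 1 := by
      apply free_map_ne _ _ hl
      intro a ha b hb hab
      by_contra hne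
      have h1 : (a.1.out)⁻¹ * b.1.out ∉ H := by
        rw [← QuotientGroup.eq]
        simpa using hne
      refine hf ((a.1.out)⁻¹ * b.1.out) ?_ ?_
      · refine List.mem_filter.2 ⟨List.mem_map.2 ⟨(a, b), ?_, rfl⟩, by simpa using h1⟩
        exact List.mem_product.2 ⟨ha, hb⟩
      · rw [← QuotientGroup.eq]
        rw [← QuotientGroup.out_eq' a.1, ← QuotientGroup.out_eq' b.1] at hab
        exact hab
    obtain ⟨R, _, hR, e, he⟩ := free_sep hK _ _ hne
    exact sep_of_root hK hP hR _ (e.comp (projKer H f)) ⟨z, hz1⟩ he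
  · apply KSep.of_hom (SemidirectProduct.rightHom (φ := cosetAut H))
    obtain ⟨N, hN, hKN, hg⟩ := hA z.right hr
    exact ⟨A ⧸ N, _, hKN, QuotientGroup.mk' N, fun h => hg ((QuotientGroup.eq_one_iff _).1 h)⟩

section Embed
variable {A : Type u} [Group A] (H : Subgroup A)

/-- The generalized free square. -/
abbrev FreeSq := Monoid.PushoutI (fun _ : Bool => H.subtype)

/-- The inclusion of a factor. -/
abbrev sqOf (b : Bool) : A →* FreeSq H :=
  Monoid.PushoutI.of (G := fun _ : Bool => A) (φ := fun _ : Bool => H.subtype) b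

/-- The free letter at the trivial coset. -/
def vLetter : FreeGroup (A ⧸ H) ⋊[cosetAut H] A :=
  SemidirectProduct.inl (FreeGroup.of ((1 : A) : A ⧸ H))

theorem vLetter_comm (h : H) :
    vLetter H * SemidirectProduct.inr (h : A) * (vLetter H)⁻¹ = SemidirectProduct.inr (h : A) := by
  rw [mul_inv_eq_iff_eq_mul]
  have hh : (h : A) • ((1 : A) : A ⧸ H) = ((1 : A) : A ⧸ H) := by
    change ((h * 1 : A) : A ⧸ H) = _
    rw [QuotientGroup.eq]
    simp
  ext
  · simp [vLetter, cosetAut_apply, hh]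
  · simp [vLetter]

/-- The two embeddings of `A`. -/
def sqFam (b : Bool) : A →* FreeGroup (A ⧸ H) ⋊[cosetAut H] A :=
  match b with
  | false => SemidirectProduct.inr
  | true => (MulAut.conj (vLetter H)).toMonoidHom.comp SemidirectProduct.inr

theorem sqFam_comp (b : Bool) :
    (sqFam H b).comp H.subtype = SemidirectProduct.inr.comp H.subtype := by
  cases b
  · rfl
  · apply MonoidHom.ext
    intro h
    exact vLetter_comm H h

/-- The embedding of the free square. -/
def sqHom : FreeSq H →* FreeGroup (A ⧸ H) ⋊[cosetAut H] A :=
  Monoid.PushoutI.lift (G := fun _ : Bool => A) (φ := fun _ : Bool => H.subtype)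
    (sqFam H) (SemidirectProduct.inr.comp H.subtype) (sqFam_comp H)

theorem sqHom_of (b : Bool) (a : A) : sqHom H (sqOf H b a) = sqFam H b a := by
  unfold sqHom sqOf
  rw [Monoid.PushoutI.lift_of]

/-- The swap of the two factors. -/
def sqSwap : FreeSq H →* FreeSq H :=
  Monoid.PushoutI.lift (fun b => sqOf H (!b)) (Monoid.PushoutI.base _)
    (fun b => Monoid.PushoutI.of_comp_eq_base (φ := fun _ : Bool => H.subtype) (!b))

theorem sqSwap_sqSwap (q : FreeSq H) : sqSwap H (sqSwap H q) = q := by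
  have : (sqSwap H).comp (sqSwap H) = MonoidHom.id _ := by
    apply Monoid.PushoutI.hom_ext_nonempty
    intro b
    ext a
    cases b <;> simp [sqSwap]
  exact DFunLike.congr_fun this q

/-- The swap as a permutation. -/
def swapPerm : Equiv.Perm (FreeSq H) :=
  ⟨sqSwap H, sqSwap H, sqSwap_sqSwap H, sqSwap_sqSwap H⟩

/-- The regular representation of the first factor. -/
def regHom : A →* Equiv.Perm (FreeSq H) :=
  (MulAction.toPermHom (FreeSq H) (FreeSq H)).comp (sqOf H false)

theorem swap_conj (a : A) : swapPerm H * regHom H a * (swapPerm H)⁻¹ =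
    MulAction.toPermHom (FreeSq H) (FreeSq H) (sqOf H true a) := by
  rw [mul_inv_eq_iff_eq_mul]
  ext q
  change sqSwap H (sqOf H false a * q) = sqOf H true a * sqSwap H q
  rw [map_mul]
  simp [sqSwap]

/-- The image of the letter at a coset. -/
def letterPerm (c : A ⧸ H) : Equiv.Perm (FreeSq H) :=
  Quotient.liftOn' c (fun a => regHom H a * swapPerm H * (regHom H a)⁻¹) (by
    intro a b hab
    rw [QuotientGroup.leftRel_apply] at hab
    obtain ⟨h, hh⟩ : ∃ h : H, b = a * h := ⟨⟨_, hab⟩, by simp⟩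
    have hc : swapPerm H * regHom H h * (swapPerm H)⁻¹ = regHom H h := by
      rw [swap_conj]
      change MulAction.toPermHom (FreeSq H) (FreeSq H) _ = MulAction.toPermHom (FreeSq H) (FreeSq H) _
      congr 1
      exact (Monoid.PushoutI.of_apply_eq_base (fun _ : Bool => H.subtype) true h).trans
        (Monoid.PushoutI.of_apply_eq_base (fun _ : Bool => H.subtype) false h).symm
    rw [mul_inv_eq_iff_eq_mul] at hc
    subst hh
    simp only [map_mul, mul_inv_rev]
    rw [mul_assoc (regHom H a) (regHom H h), ← hc]
    group)

theorem letterPerm_mk (a : A) :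
    letterPerm H (a : A ⧸ H) = regHom H a * swapPerm H * (regHom H a)⁻¹ := rfl

/-- A homomorphism showing that `sqHom` is injective. -/
def backHom : FreeGroup (A ⧸ H) ⋊[cosetAut H] A →* Equiv.Perm (FreeSq H) :=
  SemidirectProduct.lift (FreeGroup.lift (letterPerm H)) (regHom H) (by
    intro g
    apply FreeGroup.ext_hom
    intro c
    induction c using QuotientGroup.induction_on with
    | H x =>
    change FreeGroup.lift (letterPerm H) (FreeGroup.of ((g * x : A) : A ⧸ H)) =
      regHom H g * FreeGroup.lift (letterPerm H) (FreeGroup.of (x : A ⧸ H)) * (regHom H g)⁻¹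
    simp only [FreeGroup.lift_apply_of, letterPerm_mk, map_mul, mul_inv_rev]
    group)

theorem sqHom_false (a : A) : sqHom H (sqOf H false a) = SemidirectProduct.inr a := by
  rw [sqHom_of]; rfl

theorem sqHom_true (a : A) : sqHom H (sqOf H true a) =
    vLetter H * SemidirectProduct.inr a * (vLetter H)⁻¹ := by
  rw [sqHom_of]; rfl

theorem backHom_inr (a : A) : backHom H (SemidirectProduct.inr a) = regHom H a :=
  SemidirectProduct.lift_inr _ _ _ a

theorem backHom_v : backHom H (vLetter H) = swapPerm H := by
  have h : backHom H (vLetter H) = FreeGroup.lift (letterPerm H) (FreeGroup.of ((1 : A) : A ⧸ H)) :=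
    SemidirectProduct.lift_inl _ _ _ _
  rw [h, FreeGroup.lift_apply_of, letterPerm_mk, map_one, one_mul, inv_one, mul_one]

theorem back_sq (q : FreeSq H) :
    backHom H (sqHom H q) = MulAction.toPermHom (FreeSq H) (FreeSq H) q := by
  have : (backHom H).comp (sqHom H) = MulAction.toPermHom (FreeSq H) (FreeSq H) := by
    apply Monoid.PushoutI.hom_ext_nonempty
    intro b
    apply MonoidHom.ext
    intro a
    cases b
    · exact (congrArg (backHom H) (sqHom_false H a)).trans (backHom_inr H a)
    · refine (congrArg (backHom H) (sqHom_true H a)).trans ?_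
      rw [map_mul, map_mul, map_inv, backHom_inr, backHom_v]
      exact swap_conj H a
  exact DFunLike.congr_fun this q

theorem sqHom_ne (q : FreeSq H) (hq : q ≠ 1) : sqHom H q ≠ 1 := by
  intro h
  have := back_sq H q
  rw [h, map_one] at this
  have h2 := DFunLike.congr_fun this (1 : FreeSq H)
  apply hq
  simpa using h2.symm

end Embed

/-- Theorem 4, sufficiency: if `A` is `K`-residual and `H` is a `K`-closed
subgroup of `A`, for a root class `K`, then the generalized free square `Q = A *_H A`
(the pushout of two copies of the inclusion `H → A`) is `K`-residual. -/
theorem free_square_kResidual_of_kResidual_of_kClosed (K : GroupClass.{u})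
    (hK : IsRootClass K) (A : Type u) [Group A] (H : Subgroup A)
    (hA : KResidual K A) (hH : KClosed K H) :
    KResidual K (Monoid.PushoutI (fun _ : Bool => H.subtype)) := by
  exact kResidual_of_sep hK fun q hq =>
    KSep.of_hom (sqHom H) (semidirect_sep hK hA hH _ (sqHom_ne H q hq))
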